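/- Parametrized Morse lemma: Let h : W × V → ℝ be smooth on finite-dimensional normed spaces with d_v h(0,0) = 0 and d²_v h(0,0) nondegenerate, and let σ(λ) be the smooth function with d_v h(λ, σ(λ)) = 0 near 0. Then there exist neighborhoods U₁ of 0 in W and U₂ of 0 in V and a smooth map τ(λ,v) = (λ, y(λ,v)) with τ(0,0) = (0,0), which is a diffeomorphism onto its open image, such that h(λ,v) = h(λ, σ(λ)) + (1/2) d²_v h(λ, σ(λ))(y(λ,v), y(λ,v)) on U₁ × U₂. -/

import Mathlib

open Set Filter Topology in
theorem aux_param_fderiv {E F : Type*} [NormedAddCommGroup E] [NormedSpace ℝ E]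
    [FiniteDimensional ℝ E] [NormedAddCommGroup F] [NormedSpace ℝ F] [CompleteSpace F]
    (f : E → ℝ → F) (hf : ContDiff ℝ 1 (Function.uncurry f)) (x₀ : E) :
    HasFDerivAt (fun x => ∫ t in (0:ℝ)..1, f x t)
      (∫ t in (0:ℝ)..1, fderiv ℝ (fun x => f x t) x₀) x₀ := by
  have : ProperSpace E := FiniteDimensional.proper_real E
  have hc : Continuous (fun q : E × ℝ => fderiv ℝ (fun x => f x q.2) q.1) := by
    have : ContDiff ℝ 0 (fun q : E × ℝ => fderiv ℝ ((fun q x => f x q.2 : E × ℝ → E → F) q) q.1) :=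
      ContDiff.fderiv (m := 1)
        (hf.comp (contDiff_snd.prodMk (contDiff_snd.comp contDiff_fst))) contDiff_fst (by simp)
    exact this.continuous
  obtain ⟨M, hM⟩ := ((isCompact_closedBall x₀ 1).prod (isCompact_Icc (a := (0:ℝ)) (b := 1))).exists_bound_of_continuousOn
    hc.continuousOn
  have hfc : ∀ x, Continuous (f x) := fun x =>
    hf.continuous.comp (Continuous.prodMk_right x)
  refine intervalIntegral.hasFDerivAt_integral_of_dominated_of_fderiv_le
    (F' := fun x t => fderiv ℝ (fun x => f x t) x) (bound := fun _ => M)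
    (Metric.closedBall_mem_nhds x₀ one_pos) ?_ ?_ ?_ ?_ ?_ ?_
  · exact Eventually.of_forall fun x => (hfc x).aestronglyMeasurable
  · exact (hfc x₀).intervalIntegrable _ _
  · exact (hc.comp (Continuous.prodMk_right x₀)).aestronglyMeasurable
  · refine Eventually.of_forall fun t ht x hx => hM (x, t) ⟨hx, ?_⟩
    rw [uIoc_of_le zero_le_one] at ht
    exact ⟨ht.1.le, ht.2⟩
  · exact intervalIntegrable_const
  · refine Eventually.of_forall fun t ht x hx => ?_
    have : Differentiable ℝ (fun x => f x t) :=
      (hf.comp (contDiff_id.prodMk contDiff_const)).differentiable (by simp)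
    exact (this x).hasFDerivAt

theorem aux_param_nat.{u, v} {E : Type u} [NormedAddCommGroup E] [NormedSpace ℝ E]
    [FiniteDimensional ℝ E] (n : ℕ) : ∀ {F : Type (max u v)} [NormedAddCommGroup F]
    [NormedSpace ℝ F] [CompleteSpace F]
    (f : E → ℝ → F) (_ : ContDiff ℝ n (Function.uncurry f)),
    ContDiff ℝ n (fun x => ∫ t in (0:ℝ)..1, f x t) := by
  induction n with
  | zero =>
    intro F _ _ _ f hf
    simp only [Nat.cast_zero, contDiff_zero] at hf ⊢
    exact intervalIntegral.continuous_parametric_intervalIntegral_of_continuous' hf 0 1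
  | succ n ih =>
    intro F _ _ _ f hf
    have h1 : ContDiff ℝ 1 (Function.uncurry f) := hf.of_le (by simp)
    have hd := aux_param_fderiv f h1
    push_cast
    rw [contDiff_succ_iff_fderiv]
    refine ⟨fun x => (hd x).differentiableAt, by simp, ?_⟩
    have : fderiv ℝ (fun x => ∫ t in (0:ℝ)..1, f x t) =
      fun x => ∫ t in (0:ℝ)..1, fderiv ℝ (fun x => f x t) x := funext fun x => (hd x).fderiv
    rw [this]
    refine ih _ ?_
    exact ContDiff.fderiv (f := fun (q : E × ℝ) x => f x q.2) (g := fun q => q.1)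
        (hf.comp (contDiff_snd.prodMk (contDiff_snd.comp contDiff_fst))) contDiff_fst (by simp)

theorem aux_param0.{u, v} {E : Type u} [NormedAddCommGroup E] [NormedSpace ℝ E]
    [FiniteDimensional ℝ E] {F : Type (max u v)} [NormedAddCommGroup F]
    [NormedSpace ℝ F] [CompleteSpace F]
    (f : E → ℝ → F) (hf : ContDiff ℝ (⊤ : ℕ∞) (Function.uncurry f)) :
    ContDiff ℝ (⊤ : ℕ∞) (fun x => ∫ t in (0:ℝ)..1, f x t) := by
  rw [contDiff_infty] at hf ⊢
  exact fun n => aux_param_nat.{u, v} n f (hf n)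

theorem aux_param.{u, v} {E : Type u} [NormedAddCommGroup E] [NormedSpace ℝ E]
    [FiniteDimensional ℝ E] {F : Type v} [NormedAddCommGroup F]
    [NormedSpace ℝ F] [CompleteSpace F]
    (f : E → ℝ → F) (hf : ContDiff ℝ (⊤ : ℕ∞) (Function.uncurry f)) :
    ContDiff ℝ (⊤ : ℕ∞) (fun x => ∫ t in (0:ℝ)..1, f x t) := by
  let L : ULift.{u} F ≃L[ℝ] F := ContinuousLinearEquiv.ulift
  have : CompleteSpace (ULift.{u} F) := (completeSpace_congr (e := L.toEquiv) L.isUniformEmbedding).2 inferInstance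
  have h1 := aux_param0.{u, v} (F := ULift.{u} F) (fun x t => L.symm (f x t))
    (L.symm.contDiff.comp hf)
  have h2 := L.contDiff.comp h1
  have h4 : (fun x => ∫ t in (0:ℝ)..1, f x t) =
      (L ∘ fun x => ∫ t in (0:ℝ)..1, L.symm (f x t)) := ?_
  · rw [h4]; exact h2
  funext x
  have hc : Continuous (fun t => L.symm (f x t)) :=
    L.symm.continuous.comp (hf.continuous.comp (Continuous.prodMk_right x))
  have h3 := (L : ULift.{u} F →L[ℝ] F).intervalIntegral_comp_comm
    (hc.intervalIntegrable (μ := MeasureTheory.volume) 0 1)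
  simpa using h3

open Set Filter Topology in
theorem aux_local_diffeo {E : Type*} [NormedAddCommGroup E] [NormedSpace ℝ E]
    [CompleteSpace E] (f : E → E) (s : Set E) (hs : IsOpen s) (x₀ : E) (hx : x₀ ∈ s)
    (hf : ContDiffOn ℝ (⊤ : ℕ∞) f s) (f' : E ≃L[ℝ] E)
    (hf' : HasFDerivAt f (f' : E →L[ℝ] E) x₀) :
    ∃ t, IsOpen t ∧ x₀ ∈ t ∧ t ⊆ s ∧ InjOn f t ∧ ∃ g : E → E, (∀ x ∈ t, g (f x) = x) ∧
      ∀ u, IsOpen u → u ⊆ t → IsOpen (f '' u) ∧ ContDiffOn ℝ (⊤ : ℕ∞) g (f '' u) := by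
  have hfa : ∀ x ∈ s, ContDiffAt ℝ (⊤ : ℕ∞) f x := fun x hx => hf.contDiffAt (hs.mem_nhds hx)
  have h0 := hfa x₀ hx
  let e := h0.toOpenPartialHomeomorph f hf' (by simp)
  have he : (e : E → E) = f := rfl
  have hx0 : x₀ ∈ e.source := h0.mem_toOpenPartialHomeomorph_source hf' (by simp)
  have hcont : ContinuousOn (fderiv ℝ f) s := hf.continuousOn_fderiv_of_isOpen hs (by simp)
  have hopen : IsOpen (s ∩ fderiv ℝ f ⁻¹' (range ((↑) : (E ≃L[ℝ] E) → E →L[ℝ] E))) :=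
    hcont.isOpen_inter_preimage hs ContinuousLinearEquiv.isOpen
  refine ⟨e.source ∩ (s ∩ fderiv ℝ f ⁻¹' (range ((↑) : (E ≃L[ℝ] E) → E →L[ℝ] E))),
    e.open_source.inter hopen, ⟨hx0, hx, f', hf'.fderiv.symm⟩, fun x hx => hx.2.1,
    fun x hx y hy hxy => e.injOn hx.1 hy.1 hxy, e.symm, fun x hx => e.left_inv hx.1, ?_⟩
  intro u hu hut
  refine ⟨e.isOpen_image_of_subset_source hu fun x hx => (hut hx).1, ?_⟩
  rintro _ ⟨x, hx, rfl⟩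
  obtain ⟨h1, h2, e', he'⟩ := hut hx
  have hd : HasFDerivAt f (e' : E →L[ℝ] E) x := by
    rw [he']; exact ((hfa x h2).differentiableAt (by simp)).hasFDerivAt
  have hl : e.symm (f x) = x := e.left_inv h1
  refine (e.contDiffAt_symm (f₀' := e') (a := f x) (e.map_source h1) ?_ ?_).contDiffWithinAt
  · rw [hl]; exact hd
  · rw [hl]; exact hfa x h2

theorem aux_smul {E F : Type*} [NormedAddCommGroup E] [NormedSpace ℝ E] [NormedAddCommGroup F]
    [NormedSpace ℝ F] {c : E → ℝ} {f : E → F} (hc : ContDiff ℝ (⊤ : ℕ∞) c)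
    (hf : ContDiff ℝ (⊤ : ℕ∞) f) : ContDiff ℝ (⊤ : ℕ∞) (fun x => c x • f x) := hc.smul hf

open Set in
theorem aux_sqrt (V : Type*) [NormedAddCommGroup V] [NormedSpace ℝ V] [FiniteDimensional ℝ V] :
    ∃ t : Set (V →L[ℝ] V), IsOpen t ∧ 1 ∈ t ∧ InjOn (fun S => S * S) t ∧
      ∃ g : (V →L[ℝ] V) → (V →L[ℝ] V), (∀ x ∈ t, g (x * x) = x) ∧
      IsOpen ((fun S => S * S) '' t) ∧ ContDiffOn ℝ (⊤ : ℕ∞) g ((fun S => S * S) '' t) := by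
  have : CompleteSpace V := FiniteDimensional.complete ℝ V
  let f' : (V →L[ℝ] V) ≃L[ℝ] (V →L[ℝ] V) :=
    ContinuousLinearEquiv.smulLeft (Units.mk0 (2:ℝ) two_ne_zero)
  have hd : HasFDerivAt (fun S : V →L[ℝ] V => S * S) (f' : (V →L[ℝ] V) →L[ℝ] (V →L[ℝ] V)) 1 := by
    have h1 := (hasFDerivAt_id (𝕜 := ℝ) (1 : V →L[ℝ] V)).mul' (hasFDerivAt_id (𝕜 := ℝ) (1 : V →L[ℝ] V))
    refine h1.congr_fderiv ?_
    apply ContinuousLinearMap.ext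
    intro S
    change 1 * S + S * 1 = (2:ℝ) • S
    rw [two_smul, one_mul, mul_one]
  obtain ⟨t, h1, h2, -, h4, g, h5, h6⟩ := aux_local_diffeo (fun S : V →L[ℝ] V => S * S) univ
    isOpen_univ 1 trivial (contDiff_id.mul contDiff_id).contDiffOn f' hd
  exact ⟨t, h1, h2, h4, g, h5, h6 t h1 subset_rfl⟩

/-- fiberwise Hessian -/
noncomputable def auxH {W V : Type*} [NormedAddCommGroup W] [NormedSpace ℝ W]
    [NormedAddCommGroup V] [NormedSpace ℝ V] (h : W × V → ℝ) (p : W × V) : V →L[ℝ] V →L[ℝ] ℝ :=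
  fderiv ℝ (fun v : V => fderiv ℝ (fun v' : V => h (p.1, v')) v) p.2

noncomputable def auxG {W V : Type*} [NormedAddCommGroup W] [NormedSpace ℝ W]
    [NormedAddCommGroup V] [NormedSpace ℝ V] (h : W × V → ℝ) (q : W × V × V) :
    V →L[ℝ] V →L[ℝ] ℝ :=
  ∫ t in (0:ℝ)..1, (2 * (1 - t)) • auxH h (q.1, q.2.1 + t • q.2.2)

set_option linter.unusedSectionVars false
section
variable {W V : Type*} [NormedAddCommGroup W] [NormedSpace ℝ W] [FiniteDimensional ℝ W]
    [NormedAddCommGroup V] [NormedSpace ℝ V] [FiniteDimensional ℝ V]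
    (h : W × V → ℝ)

theorem auxD_contDiff (hh : ContDiff ℝ (⊤ : ℕ∞) h) : ContDiff ℝ (⊤ : ℕ∞)
    (fun p : W × V => fderiv ℝ (fun v' : V => h (p.1, v')) p.2) :=
  ContDiff.fderiv (m := (⊤ : ℕ∞)) (f := fun (p : W × V) v => h (p.1, v)) (g := fun p => p.2)
    (hh.comp ((contDiff_fst.comp contDiff_fst).prodMk contDiff_snd)) contDiff_snd (by simp)

theorem auxH_contDiff (hh : ContDiff ℝ (⊤ : ℕ∞) h) : ContDiff ℝ (⊤ : ℕ∞) (auxH h) :=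
  ContDiff.fderiv (m := (⊤ : ℕ∞))
    (f := fun (p : W × V) v => fderiv ℝ (fun v' : V => h (p.1, v')) v) (g := fun p => p.2)
    ((auxD_contDiff h hh).comp ((contDiff_fst.comp contDiff_fst).prodMk contDiff_snd))
    contDiff_snd (by simp)

theorem auxH_symm (hh : ContDiff ℝ (⊤ : ℕ∞) h) (p : W × V) (v w : V) : auxH h p v w = auxH h p w v := by
  have : ContDiff ℝ (⊤ : ℕ∞) (fun v' : V => h (p.1, v')) :=
    hh.comp (contDiff_const.prodMk contDiff_id)
  exact (this.contDiffAt (x := p.2)).isSymmSndFDerivAt (by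
    rw [minSmoothness_of_isRCLikeNormedField]; exact WithTop.coe_le_coe.2 le_top) v w

theorem auxI_contDiff (hh : ContDiff ℝ (⊤ : ℕ∞) h) : ContDiff ℝ (⊤ : ℕ∞) (fun x : (W × V × V) × ℝ =>
    (2 * (1 - x.2)) • auxH h (x.1.1, x.1.2.1 + x.2 • x.1.2.2)) := by
  have h1 : ContDiff ℝ (⊤ : ℕ∞) (fun x : (W × V × V) × ℝ => 2 * (1 - x.2)) := by fun_prop
  have h2 : ContDiff ℝ (⊤ : ℕ∞)
      (fun x : (W × V × V) × ℝ => (x.1.1, x.1.2.1 + x.2 • x.1.2.2)) := by fun_prop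
  have h3 := (auxH_contDiff h hh).comp h2
  exact aux_smul h1 h3

theorem auxG_contDiff (hh : ContDiff ℝ (⊤ : ℕ∞) h) : ContDiff ℝ (⊤ : ℕ∞) (auxG h) :=
  aux_param (fun (q : W × V × V) t => (2 * (1 - t)) • auxH h (q.1, q.2.1 + t • q.2.2))
    (auxI_contDiff h hh)

theorem auxG_apply (hh : ContDiff ℝ (⊤ : ℕ∞) h) (q : W × V × V) (v w : V) : auxG h q v w =
    ∫ t in (0:ℝ)..1, (2 * (1 - t)) * auxH h (q.1, q.2.1 + t • q.2.2) v w := by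
  have hc : Continuous fun t : ℝ => (2 * (1 - t)) • auxH h (q.1, q.2.1 + t • q.2.2) :=
    (auxI_contDiff h hh).continuous.comp (Continuous.prodMk_right q)
  have h1 := ContinuousLinearMap.intervalIntegral_apply (φ := fun t : ℝ =>
    (2 * (1 - t)) • auxH h (q.1, q.2.1 + t • q.2.2)) (hc.intervalIntegrable (μ := MeasureTheory.volume) 0 1) v
  have h2 := ContinuousLinearMap.intervalIntegral_apply (φ := fun t : ℝ =>
    ((2 * (1 - t)) • auxH h (q.1, q.2.1 + t • q.2.2)) v)
    ((hc.clm_apply continuous_const).intervalIntegrable (μ := MeasureTheory.volume) 0 1) w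
  rw [auxG, h1, h2]
  rfl

theorem auxG_symm (hh : ContDiff ℝ (⊤ : ℕ∞) h) (q : W × V × V) (v w : V) : auxG h q v w = auxG h q w v := by
  simp only [auxG_apply h hh, auxH_symm h hh _ v w]

theorem auxG_zero (hh : ContDiff ℝ (⊤ : ℕ∞) h) (l : W) (a : V) : auxG h (l, a, 0) = auxH h (l, a) := by
  ext v w
  rw [auxG_apply h hh]
  simp only [smul_zero, add_zero]
  rw [intervalIntegral.integral_mul_const]
  have : ∫ t in (0:ℝ)..1, 2 * (1 - t) = 1 := by
    rw [intervalIntegral.integral_const_mul, intervalIntegral.integral_sub (by simp) (by simp)]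
    simp; norm_num
  rw [this, one_mul]

theorem aux_taylor (hh : ContDiff ℝ (⊤ : ℕ∞) h) (l : W) (a w : V) (hcrit : fderiv ℝ (fun v : V => h (l, v)) a = 0) :
    h (l, a + w) = h (l, a) + (1 / 2) * auxG h (l, a, w) w w := by
  have hφ : ∀ t : ℝ, HasDerivAt (fun t : ℝ => h (l, a + t • w))
      (fderiv ℝ (fun v' : V => h (l, v')) (a + t • w) w) t := by
    intro t
    have h1 : HasFDerivAt (fun v' : V => h (l, v')) (fderiv ℝ (fun v' : V => h (l, v')) (a + t • w))
      (a + t • w) := (((hh.comp (contDiff_const.prodMk contDiff_id)).differentiable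
        (by simp)) _).hasFDerivAt
    have h2 : HasDerivAt (fun t : ℝ => a + t • w) w t := by
      simpa using ((hasDerivAt_id t).smul_const w).const_add a
    exact h1.comp_hasDerivAt t h2
  have hφ' : ∀ t : ℝ, HasDerivAt (fun t : ℝ => fderiv ℝ (fun v' : V => h (l, v')) (a + t • w) w)
      (auxH h (l, a + t • w) w w) t := by
    intro t
    have h1 : HasFDerivAt (fun v : V => fderiv ℝ (fun v' : V => h (l, v')) v)
      (auxH h (l, a + t • w))
      (a + t • w) := ((((auxD_contDiff h hh).comp (contDiff_const (c := l)|>.prodMk contDiff_id)).differentiable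
        (by simp)) _).hasFDerivAt
    have h2 : HasDerivAt (fun t : ℝ => a + t • w) w t := by
      simpa using ((hasDerivAt_id t).smul_const w).const_add a
    have h3 := h1.comp_hasDerivAt t h2
    simpa using h3.clm_apply (hasDerivAt_const t w)
  have hF : ∀ t : ℝ, HasDerivAt (fun t : ℝ => 2 * h (l, a + t • w) + (2 * (1 - t)) *
      fderiv ℝ (fun v' : V => h (l, v')) (a + t • w) w)
      ((2 * (1 - t)) * auxH h (l, a + t • w) w w) t := by
    intro t
    have h3 : HasDerivAt (fun t : ℝ => 2 * (1 - t)) (-2) t := by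
      simpa using ((hasDerivAt_id t).const_sub 1).const_mul 2
    refine (((hφ t).const_mul 2).add (h3.mul (hφ' t))).congr_deriv ?_
    ring
  have hc : Continuous fun t : ℝ => (2 * (1 - t)) * auxH h (l, a + t • w) w w := by
    have hc : Continuous fun t : ℝ => (2 * (1 - t)) • auxH h (l, a + t • w) :=
      (auxI_contDiff h hh).continuous.comp (Continuous.prodMk_right (l, a, w))
    exact (hc.clm_apply continuous_const).clm_apply continuous_const
  have := intervalIntegral.integral_eq_sub_of_hasDerivAt (fun t _ => hF t)
    (hc.intervalIntegrable 0 1)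
  rw [auxG_apply h hh, this]
  simp [hcrit]
  ring
end

/-- adjoint of `R` with respect to `A` -/
noncomputable def auxAdj {V : Type*} [NormedAddCommGroup V] [NormedSpace ℝ V]
    (A : V →L[ℝ] V →L[ℝ] ℝ) (R : V →L[ℝ] V) : V →L[ℝ] V :=
  A.inverse ∘L (((ContinuousLinearMap.compL ℝ V V ℝ).flip R) ∘L A)

open Set in
theorem aux_alg {V : Type*} [NormedAddCommGroup V] [NormedSpace ℝ V]
    (A B : V →L[ℝ] V →L[ℝ] ℝ) (hA : ∀ v w, A v w = A w v) (hB : ∀ v w, B v w = B w v)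
    (hi : A ∈ range ((↑) : (V ≃L[ℝ] (V →L[ℝ] ℝ)) → V →L[ℝ] V →L[ℝ] ℝ))
    (R : V →L[ℝ] V) (hR : R * R = A.inverse ∘L B) (t : Set (V →L[ℝ] V))
    (ht : InjOn (fun S => S * S) t) (h1 : R ∈ t) (h2 : auxAdj A R ∈ t) (w : V) :
    A (R w) (R w) = B w w := by
  obtain ⟨e, rfl⟩ := hi
  have hinv : ∀ f, (e : V →L[ℝ] V →L[ℝ] ℝ) ((e : V →L[ℝ] V →L[ℝ] ℝ).inverse f) = f := by
    intro f
    rw [ContinuousLinearMap.inverse_equiv]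
    exact e.apply_symm_apply f
  generalize hAe : (e : V →L[ℝ] V →L[ℝ] ℝ) = A at *
  have hinj : Function.Injective A := by rw [← hAe]; exact e.injective
  have hadj : ∀ u v, A (auxAdj A R u) v = A u (R v) := by
    intro u v
    have : A (auxAdj A R u) = (A u) ∘L R := hinv _
    rw [this]; rfl
  have hRR : ∀ v, A (R (R v)) = B v := by
    intro v
    have : R (R v) = A.inverse (B v) := DFunLike.congr_fun hR v
    rw [this, hinv]
  have heq : auxAdj A R = R := by
    apply ht h2 h1
    ext u
    apply hinj
    ext v
    change A (auxAdj A R (auxAdj A R u)) v = A (R (R u)) v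
    rw [hadj, hadj, hRR, hA, hRR, hB]
  calc A (R w) (R w) = A (auxAdj A R w) (R w) := by rw [heq]
    _ = B w w := by rw [hadj, hA, hRR]

theorem auxAdj_one {V : Type*} [NormedAddCommGroup V] [NormedSpace ℝ V]
    (e : V ≃L[ℝ] (V →L[ℝ] ℝ)) : auxAdj (e : V →L[ℝ] V →L[ℝ] ℝ) 1 = 1 := by
  ext u
  simp only [auxAdj, ContinuousLinearMap.inverse_equiv]
  exact e.symm_apply_apply u

open Set Filter Topology in
theorem stmt_2
    {W V : Type*} [NormedAddCommGroup W] [NormedSpace ℝ W] [FiniteDimensional ℝ W]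
    [NormedAddCommGroup V] [NormedSpace ℝ V] [FiniteDimensional ℝ V]
    (h : W × V → ℝ) (hh : ContDiff ℝ (⊤ : ℕ∞) h)
    (hcrit : fderiv ℝ (fun v : V => h (0, v)) 0 = 0)
    (hnd : Function.Injective
      (fderiv ℝ (fun v : V => fderiv ℝ (fun v' : V => h (0, v')) v) 0))
    (U : Set W) (hU : U ∈ nhds (0 : W)) (σ : W → V)
    (hσ : ContDiffOn ℝ (⊤ : ℕ∞) σ U) (hσ0 : σ 0 = 0)
    (hσcrit : ∀ l ∈ U, fderiv ℝ (fun v : V => h (l, v)) (σ l) = 0) :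
    ∃ U₁ ∈ nhds (0 : W), ∃ U₂ ∈ nhds (0 : V), ∃ y : W × V → V,
      U₁ ⊆ U ∧
      -- τ(λ,v) = (λ, y(λ,v)) is smooth, fixes the origin,
      ContDiffOn ℝ (⊤ : ℕ∞) y (U₁ ×ˢ U₂) ∧ y (0, 0) = 0 ∧
      -- τ is a diffeomorphism of U₁ × U₂ onto its open image:
      Set.InjOn (fun p : W × V => (p.1, y p)) (U₁ ×ˢ U₂) ∧
      IsOpen ((fun p : W × V => (p.1, y p)) '' (U₁ ×ˢ U₂)) ∧
      (∃ τinv : W × V → W × V,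
        ContDiffOn ℝ (⊤ : ℕ∞) τinv ((fun p : W × V => (p.1, y p)) '' (U₁ ×ˢ U₂)) ∧
        ∀ p ∈ U₁ ×ˢ U₂, τinv (p.1, y p) = p) ∧
      -- the normal form of h:
      ∀ p ∈ U₁ ×ˢ U₂,
        h p = h (p.1, σ p.1) +
          (1 / 2) *
            fderiv ℝ (fun v : V => fderiv ℝ (fun v' : V => h (p.1, v')) v)
              (σ p.1) (y p) (y p) := by
  have : CompleteSpace V := FiniteDimensional.complete ℝ V
  have : CompleteSpace W := FiniteDimensional.complete ℝ W
  obtain ⟨t, ht, ht1, htinj, g, hg, hfo, hgs⟩ := aux_sqrt V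
  -- the base open set
  let s0 : Set (W × V) := interior U ×ˢ univ
  have hs0 : IsOpen s0 := isOpen_interior.prod isOpen_univ
  have hz0 : ((0 : W), (0 : V)) ∈ s0 := ⟨mem_interior_iff_mem_nhds.2 hU, trivial⟩
  have hσ' : ContDiffOn ℝ (⊤ : ℕ∞) (fun p : W × V => σ p.1) s0 :=
    hσ.comp contDiff_fst.contDiffOn fun p hp => interior_subset hp.1
  let A : W × V → (V →L[ℝ] V →L[ℝ] ℝ) := fun p => auxH h (p.1, σ p.1)
  let B : W × V → (V →L[ℝ] V →L[ℝ] ℝ) := fun p => auxG h (p.1, σ p.1, p.2 - σ p.1)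
  have hA : ContDiffOn ℝ (⊤ : ℕ∞) A s0 :=
    (auxH_contDiff h hh).comp_contDiffOn (contDiff_fst.contDiffOn.prodMk hσ')
  have hB : ContDiffOn ℝ (⊤ : ℕ∞) B s0 :=
    (auxG_contDiff h hh).comp_contDiffOn (contDiff_fst.contDiffOn.prodMk
      (hσ'.prodMk (contDiff_snd.contDiffOn.sub hσ')))
  have hA0 : A (0, 0) ∈ range ((↑) : (V ≃L[ℝ] (V →L[ℝ] ℝ)) → V →L[ℝ] V →L[ℝ] ℝ) := by
    have hinj : Function.Injective (A (0, 0)) := by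
      change Function.Injective (auxH h (0, σ 0))
      rw [hσ0]; exact hnd
    have hdim : Module.finrank ℝ V = Module.finrank ℝ (V →L[ℝ] ℝ) := by
      rw [← (LinearMap.toContinuousLinearMap (𝕜 := ℝ) (E := V) (F' := ℝ)).finrank_eq]
      exact (Subspace.dual_finrank_eq (K := ℝ) (V := V)).symm
    refine ⟨(LinearEquiv.ofInjectiveOfFinrankEq (A (0, 0)).toLinearMap hinj hdim).toContinuousLinearEquiv, ?_⟩
    ext u v
    rfl
  have hAB0 : B (0, 0) = A (0, 0) := by
    change auxG h (0, σ 0, 0 - σ 0) = auxH h (0, σ 0)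
    rw [hσ0, sub_zero, auxG_zero h hh]
  let s1 : Set (W × V) := s0 ∩ A ⁻¹' (range ((↑) : (V ≃L[ℝ] (V →L[ℝ] ℝ)) → V →L[ℝ] V →L[ℝ] ℝ))
  have hs1 : IsOpen s1 := hA.continuousOn.isOpen_inter_preimage hs0 ContinuousLinearEquiv.isOpen
  have hz1 : ((0 : W), (0 : V)) ∈ s1 := ⟨hz0, hA0⟩
  have hAi : ContDiffOn ℝ (⊤ : ℕ∞) (fun p => (A p).inverse) s1 := by
    rintro p ⟨hp, e, he⟩
    have h1 : ContDiffAt ℝ (⊤ : ℕ∞) ContinuousLinearMap.inverse (A p) := by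
      rw [← he]; exact contDiffAt_map_inverse e
    exact h1.comp_contDiffWithinAt p ((hA p hp).mono inter_subset_left)
  let C : W × V → (V →L[ℝ] V) := fun p => (A p).inverse ∘L B p
  have hC : ContDiffOn ℝ (⊤ : ℕ∞) C s1 := hAi.clm_comp (hB.mono inter_subset_left)
  have hC0 : C (0, 0) = 1 := by
    obtain ⟨e, he⟩ := hA0
    change (A (0, 0)).inverse ∘L B (0, 0) = 1
    rw [hAB0, ← he, ContinuousLinearMap.inverse_equiv]
    ext u
    exact e.symm_apply_apply u
  let s2 : Set (W × V) := s1 ∩ C ⁻¹' ((fun S => S * S) '' t)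
  have hs2 : IsOpen s2 := hC.continuousOn.isOpen_inter_preimage hs1 hfo
  have hz2 : ((0 : W), (0 : V)) ∈ s2 := ⟨hz1, 1, ht1, by rw [hC0]; exact mul_one 1⟩
  let R : W × V → (V →L[ℝ] V) := fun p => g (C p)
  have hR : ContDiffOn ℝ (⊤ : ℕ∞) R s2 :=
    hgs.comp (hC.mono inter_subset_left) fun p hp => hp.2
  have hR0 : R (0, 0) = 1 := by
    change g (C (0, 0)) = 1
    rw [hC0]
    simpa using hg 1 ht1
  have hRt : ∀ p ∈ s2, R p ∈ t ∧ R p * R p = C p := by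
    rintro p ⟨-, S, hS, hSC⟩
    have : R p = S := by
      change g (C p) = S
      rw [← hSC]; exact hg S hS
    rw [this]; exact ⟨hS, hSC⟩
  have hRs : ContinuousOn (fun p => auxAdj (A p) (R p)) s2 := by
    have hs21 : s2 ⊆ s1 := inter_subset_left
    have hs10 : s1 ⊆ s0 := inter_subset_left
    have h1 : ContinuousOn (fun p => (ContinuousLinearMap.compL ℝ V V ℝ).flip (R p)) s2 :=
      (ContinuousLinearMap.continuous _).comp_continuousOn hR.continuousOn
    exact (hAi.continuousOn.mono hs21).clm_comp
      (h1.clm_comp (hA.continuousOn.mono (hs21.trans hs10)))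
  let s3 : Set (W × V) := s2 ∩ (fun p => auxAdj (A p) (R p)) ⁻¹' t
  have hs3 : IsOpen s3 := hRs.isOpen_inter_preimage hs2 ht
  have hz3 : ((0 : W), (0 : V)) ∈ s3 := by
    refine ⟨hz2, ?_⟩
    obtain ⟨e, he⟩ := hA0
    change auxAdj (A (0, 0)) (R (0, 0)) ∈ t
    rw [hR0, ← he, auxAdj_one]
    exact ht1
  have h32 : s3 ⊆ s2 := inter_subset_left
  have h31 : s3 ⊆ s1 := h32.trans inter_subset_left
  have h30 : s3 ⊆ s0 := h31.trans inter_subset_left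
  let y : W × V → V := fun p => R p (p.2 - σ p.1)
  have hy : ContDiffOn ℝ (⊤ : ℕ∞) y s3 :=
    (hR.mono h32).clm_apply (contDiff_snd.contDiffOn.sub (hσ'.mono h30))
  have hnormal : ∀ p ∈ s3, h p = h (p.1, σ p.1) + (1 / 2) * auxH h (p.1, σ p.1) (y p) (y p) := by
    intro p hp
    have h1 := aux_taylor h hh p.1 (σ p.1) (p.2 - σ p.1) (hσcrit _ (interior_subset (h30 hp).1))
    rw [add_sub_cancel] at h1
    have h2 : A p (R p (p.2 - σ p.1)) (R p (p.2 - σ p.1)) =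
        B p (p.2 - σ p.1) (p.2 - σ p.1) :=
      aux_alg (A p) (B p) (auxH_symm h hh _) (auxG_symm h hh _) (h31 hp).2 (R p)
        (hRt p (h32 hp)).2 t htinj (hRt p (h32 hp)).1 hp.2 _
    change h (p.1, p.2) = _
    rw [h1]
    congr 2
    exact h2.symm
  -- derivative at the origin
  have hσd : HasFDerivAt σ (fderiv ℝ σ 0) (0 : W) :=
    ((hσ.contDiffAt hU).differentiableAt (by simp)).hasFDerivAt
  let f' : (W × V) ≃L[ℝ] (W × V) := (ContinuousLinearEquiv.refl ℝ W).skewProd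
    (ContinuousLinearEquiv.refl ℝ V) (-(fderiv ℝ σ 0))
  have hyd : HasFDerivAt (fun p : W × V => (p.1, y p)) (f' : (W × V) →L[ℝ] (W × V)) (0, 0) := by
    have hRd : HasFDerivAt R (fderiv ℝ R (0, 0)) (0, 0) :=
      ((hR.contDiffAt (hs2.mem_nhds hz2)).differentiableAt (by simp)).hasFDerivAt
    have hwd : HasFDerivAt (fun p : W × V => p.2 - σ p.1)
        (ContinuousLinearMap.snd ℝ W V - (fderiv ℝ σ 0) ∘L ContinuousLinearMap.fst ℝ W V)
        ((0 : W), (0 : V)) :=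
      hasFDerivAt_snd.sub (HasFDerivAt.comp (f := Prod.fst) ((0 : W), (0 : V)) hσd hasFDerivAt_fst)
    refine (hasFDerivAt_fst.prodMk (hRd.clm_apply hwd)).congr_fderiv ?_
    apply ContinuousLinearMap.ext
    rintro ⟨a, b⟩
    refine Prod.ext ?_ ?_
    · simp [f']
    · simp [f', hR0, hσ0, sub_eq_add_neg]
  have hτ : ContDiffOn ℝ (⊤ : ℕ∞) (fun p : W × V => (p.1, y p)) s3 :=
    contDiff_fst.contDiffOn.prodMk hy
  obtain ⟨t', h1, h2, h3, h4, G, h5, h6⟩ := aux_local_diffeo _ s3 hs3 _ hz3 hτ f' hyd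
  obtain ⟨U₁, U₂, hU1, hU10, hU2, hU20, hUt⟩ := mem_nhds_prod_iff'.1 (h1.mem_nhds h2)
  have hU3 := hUt.trans h3
  refine ⟨U₁, hU1.mem_nhds hU10, U₂, hU2.mem_nhds hU20, y, ?_, hy.mono hU3, ?_, h4.mono hUt,
    (h6 _ (hU1.prod hU2) hUt).1, ⟨G, (h6 _ (hU1.prod hU2) hUt).2, fun p hp => h5 p (hUt hp)⟩,
    fun p hp => hnormal p (hU3 hp)⟩
  · intro l hl
    exact interior_subset (h30 (hU3 (show (l, (0 : V)) ∈ U₁ ×ˢ U₂ from ⟨hl, hU20⟩))).1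
  · change R (0, 0) (0 - σ 0) = 0
    rw [hσ0]; simp
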